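/- In a (6,4) net, there is no set Λ of lines consisting of exactly two lines from each of the four parallel classes (parallax (2,2,2,2)) whose F₂-sum of characteristic functions vanishes, i.e., with c(Λ) = 0. -/

import Mathlib

/-- A `(6,4)` net on a point type `P`: 36 points, lines of size 6 indexed by
4 parallel classes of 6 lines each; each parallel class partitions the point set,
and two lines from different parallel classes meet in exactly one point. -/
structure Net64 (P : Type) [Fintype P] [DecidableEq P] where
  line : Fin 4 → Fin 6 → Finset P
  card_points : Fintype.card P = 36
  line_card : ∀ i j, (line i j).card = 6
  partition : ∀ (i : Fin 4) (p : P), ∃! j : Fin 6, p ∈ line i j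
  meet : ∀ (i i' : Fin 4) (j j' : Fin 6), i ≠ i' → (line i j ∩ line i' j').card = 1

/-- The characteristic function `v^s` of a finite set `s`, with values in `F₂`. -/
def chi {P : Type} [DecidableEq P] (s : Finset P) : P → ZMod 2 :=
  fun p => if p ∈ s then 1 else 0

/-- `c(Λ)`: the `F₂`-sum of the characteristic functions of a set of lines of the net,
a set of lines being given by the finite set of its (class, index) pairs. -/
def Net64.cSum {P : Type} [Fintype P] [DecidableEq P] (N : Net64 P)
    (Λ : Finset (Fin 4 × Fin 6)) : P → ZMod 2 :=
  ∑ x ∈ Λ, chi (N.line x.1 x.2)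

/-- `lᵢ = |Λ ∩ Πᵢ|`: the number of lines of `Λ` in the `i`-th parallel class. -/
def lcount (Λ : Finset (Fin 4 × Fin 6)) (i : Fin 4) : ℕ :=
  (Λ.filter fun x => x.1 = i).card

/-- `pⱼ`: the number of points of the net lying on exactly `j` lines of `Λ`. -/
def Net64.pcount {P : Type} [Fintype P] [DecidableEq P] (N : Net64 P)
    (Λ : Finset (Fin 4 × Fin 6)) (j : ℕ) : ℕ :=
  (Finset.univ.filter fun p : P => (Λ.filter fun x => p ∈ N.line x.1 x.2).card = j).card

set_option synthInstance.maxHeartbeats 2000000 in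
set_option synthInstance.maxSize 100000 in
set_option maxRecDepth 100000 in
set_option maxHeartbeats 2000000 in
theorem key_search :
  ∀ m01 : Fin 4, m01 ≠ 0 →
  ∀ m02 : Fin 4, m02 ≠ 0 ∧ m02 ≠ m01 →
  ∀ m03 : Fin 4, m03 ≠ 0 ∧ m03 ≠ m01 ∧ m03 ≠ m02 →
  ∀ m10 : Fin 4, m10 ≠ 1 →
  ∀ m12 : Fin 4, m12 ≠ 1 ∧ m12 ≠ m02 ∧ m12 ≠ m10 →
  ∀ m13 : Fin 4, m13 ≠ 1 ∧ m13 ≠ m03 ∧ m13 ≠ m10 ∧ m13 ≠ m12 →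
  ∀ m20 : Fin 4, m20 ≠ 2 ∧ m20 ≠ m10 →
  ∀ m21 : Fin 4, m21 ≠ 2 ∧ m21 ≠ m01 ∧ m21 ≠ m20 →
  ∀ m23 : Fin 4, m23 ≠ 2 ∧ m23 ≠ m03 ∧ m23 ≠ m13 ∧ m23 ≠ m20 ∧ m23 ≠ m21 →
  ∀ m30 : Fin 4, m30 ≠ 3 ∧ m30 ≠ m10 ∧ m30 ≠ m20 →
  ∀ m31 : Fin 4, m31 ≠ 3 ∧ m31 ≠ m01 ∧ m31 ≠ m21 ∧ m31 ≠ m30 →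
  ∀ m32 : Fin 4, m32 ≠ 3 ∧ m32 ≠ m02 ∧ m32 ≠ m12 ∧ m32 ≠ m30 ∧ m32 ≠ m31 →
  (m10 = 0 ∨ m20 = 0 ∨ m30 = 0) →
  (m01 = 1 ∨ m21 = 1 ∨ m31 = 1) →
  (m02 = 2 ∨ m12 = 2 ∨ m32 = 2) →
  (m03 = 3 ∨ m13 = 3 ∨ m23 = 3) →
  ∀ q01 : Fin 4, q01 ≠ 0 →
  ∀ q02 : Fin 4, q02 ≠ 0 ∧ q02 ≠ q01 →
  ∀ q03 : Fin 4, q03 ≠ 0 ∧ q03 ≠ q01 ∧ q03 ≠ q02 →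
  ∀ q10 : Fin 4, q10 ≠ 1 ∧ (m10 = m01 → q10 ≠ q01) ∧ (m10 = m02 → q10 ≠ q02) ∧ (m10 = m03 → q10 ≠ q03) →
  ∀ q12 : Fin 4, q12 ≠ 1 ∧ q12 ≠ q02 ∧ q12 ≠ q10 ∧ (m12 = m01 → q12 ≠ q01) ∧ (m12 = m03 → q12 ≠ q03) →
  ∀ q13 : Fin 4, q13 ≠ 1 ∧ q13 ≠ q03 ∧ q13 ≠ q10 ∧ q13 ≠ q12 ∧ (m13 = m01 → q13 ≠ q01) ∧ (m13 = m02 → q13 ≠ q02) →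
  ∀ q20 : Fin 4, q20 ≠ 2 ∧ q20 ≠ q10 ∧ (m20 = m01 → q20 ≠ q01) ∧ (m20 = m02 → q20 ≠ q02) ∧ (m20 = m03 → q20 ≠ q03) ∧ (m20 = m12 → q20 ≠ q12) ∧ (m20 = m13 → q20 ≠ q13) →
  ∀ q21 : Fin 4, q21 ≠ 2 ∧ q21 ≠ q01 ∧ q21 ≠ q20 ∧ (m21 = m02 → q21 ≠ q02) ∧ (m21 = m03 → q21 ≠ q03) ∧ (m21 = m10 → q21 ≠ q10) ∧ (m21 = m12 → q21 ≠ q12) ∧ (m21 = m13 → q21 ≠ q13) →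
  ∀ q23 : Fin 4, q23 ≠ 2 ∧ q23 ≠ q03 ∧ q23 ≠ q13 ∧ q23 ≠ q20 ∧ q23 ≠ q21 ∧ (m23 = m01 → q23 ≠ q01) ∧ (m23 = m02 → q23 ≠ q02) ∧ (m23 = m10 → q23 ≠ q10) ∧ (m23 = m12 → q23 ≠ q12) →
  ∀ q30 : Fin 4, q30 ≠ 3 ∧ q30 ≠ q10 ∧ q30 ≠ q20 ∧ (m30 = m01 → q30 ≠ q01) ∧ (m30 = m02 → q30 ≠ q02) ∧ (m30 = m03 → q30 ≠ q03) ∧ (m30 = m12 → q30 ≠ q12) ∧ (m30 = m13 → q30 ≠ q13) ∧ (m30 = m21 → q30 ≠ q21) ∧ (m30 = m23 → q30 ≠ q23) →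
  ∀ q31 : Fin 4, q31 ≠ 3 ∧ q31 ≠ q01 ∧ q31 ≠ q21 ∧ q31 ≠ q30 ∧ (m31 = m02 → q31 ≠ q02) ∧ (m31 = m03 → q31 ≠ q03) ∧ (m31 = m10 → q31 ≠ q10) ∧ (m31 = m12 → q31 ≠ q12) ∧ (m31 = m13 → q31 ≠ q13) ∧ (m31 = m20 → q31 ≠ q20) ∧ (m31 = m23 → q31 ≠ q23) →
  ∀ q32 : Fin 4, q32 ≠ 3 ∧ q32 ≠ q02 ∧ q32 ≠ q12 ∧ q32 ≠ q30 ∧ q32 ≠ q31 ∧ (m32 = m01 → q32 ≠ q01) ∧ (m32 = m03 → q32 ≠ q03) ∧ (m32 = m10 → q32 ≠ q10) ∧ (m32 = m13 → q32 ≠ q13) ∧ (m32 = m20 → q32 ≠ q20) ∧ (m32 = m21 → q32 ≠ q21) ∧ (m32 = m23 → q32 ≠ q23) →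
  False := by
  decide +kernel

theorem no_pair (M Q : Fin 4 → Fin 4 → Fin 4)
    (hMd : ∀ r c, r ≠ c → M r c ≠ r)
    (hMr : ∀ r c c', r ≠ c → r ≠ c' → c ≠ c' → M r c ≠ M r c')
    (hMc : ∀ c r r', r ≠ c → r' ≠ c → r ≠ r' → M r c ≠ M r' c)
    (hMx : ∀ c, ∃ r, r ≠ c ∧ M r c = c)
    (hQd : ∀ r c, r ≠ c → Q r c ≠ r)
    (hQr : ∀ r c c', r ≠ c → r ≠ c' → c ≠ c' → Q r c ≠ Q r c')
    (hQc : ∀ c r r', r ≠ c → r' ≠ c → r ≠ r' → Q r c ≠ Q r' c)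
    (ho : ∀ r c r' c', r ≠ c → r' ≠ c' → r ≠ r' → M r c = M r' c' → Q r c ≠ Q r' c') :
    False := by
  have hMx0 : M 1 0 = 0 ∨ M 2 0 = 0 ∨ M 3 0 = 0 := by
    obtain ⟨r, h1, h2⟩ := hMx 0
    fin_cases r <;> simp_all
  have hMx1 : M 0 1 = 1 ∨ M 2 1 = 1 ∨ M 3 1 = 1 := by
    obtain ⟨r, h1, h2⟩ := hMx 1
    fin_cases r <;> simp_all
  have hMx2 : M 0 2 = 2 ∨ M 1 2 = 2 ∨ M 3 2 = 2 := by
    obtain ⟨r, h1, h2⟩ := hMx 2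
    fin_cases r <;> simp_all
  have hMx3 : M 0 3 = 3 ∨ M 1 3 = 3 ∨ M 2 3 = 3 := by
    obtain ⟨r, h1, h2⟩ := hMx 3
    fin_cases r <;> simp_all
  exact key_search
    (M 0 1) (hMd 0 1 (by decide))
    (M 0 2) ⟨hMd 0 2 (by decide), hMr 0 2 1 (by decide) (by decide) (by decide)⟩
    (M 0 3) ⟨hMd 0 3 (by decide), hMr 0 3 1 (by decide) (by decide) (by decide), hMr 0 3 2 (by decide) (by decide) (by decide)⟩
    (M 1 0) (hMd 1 0 (by decide))
    (M 1 2) ⟨hMd 1 2 (by decide), hMc 2 1 0 (by decide) (by decide) (by decide), hMr 1 2 0 (by decide) (by decide) (by decide)⟩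
    (M 1 3) ⟨hMd 1 3 (by decide), hMc 3 1 0 (by decide) (by decide) (by decide), hMr 1 3 0 (by decide) (by decide) (by decide), hMr 1 3 2 (by decide) (by decide) (by decide)⟩
    (M 2 0) ⟨hMd 2 0 (by decide), hMc 0 2 1 (by decide) (by decide) (by decide)⟩
    (M 2 1) ⟨hMd 2 1 (by decide), hMc 1 2 0 (by decide) (by decide) (by decide), hMr 2 1 0 (by decide) (by decide) (by decide)⟩
    (M 2 3) ⟨hMd 2 3 (by decide), hMc 3 2 0 (by decide) (by decide) (by decide), hMc 3 2 1 (by decide) (by decide) (by decide), hMr 2 3 0 (by decide) (by decide) (by decide), hMr 2 3 1 (by decide) (by decide) (by decide)⟩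
    (M 3 0) ⟨hMd 3 0 (by decide), hMc 0 3 1 (by decide) (by decide) (by decide), hMc 0 3 2 (by decide) (by decide) (by decide)⟩
    (M 3 1) ⟨hMd 3 1 (by decide), hMc 1 3 0 (by decide) (by decide) (by decide), hMc 1 3 2 (by decide) (by decide) (by decide), hMr 3 1 0 (by decide) (by decide) (by decide)⟩
    (M 3 2) ⟨hMd 3 2 (by decide), hMc 2 3 0 (by decide) (by decide) (by decide), hMc 2 3 1 (by decide) (by decide) (by decide), hMr 3 2 0 (by decide) (by decide) (by decide), hMr 3 2 1 (by decide) (by decide) (by decide)⟩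
    hMx0
    (hMx1)
    (hMx2)
    (hMx3)
    (Q 0 1) (hQd 0 1 (by decide))
    (Q 0 2) ⟨hQd 0 2 (by decide), hQr 0 2 1 (by decide) (by decide) (by decide)⟩
    (Q 0 3) ⟨hQd 0 3 (by decide), hQr 0 3 1 (by decide) (by decide) (by decide), hQr 0 3 2 (by decide) (by decide) (by decide)⟩
    (Q 1 0) ⟨hQd 1 0 (by decide), ho 1 0 0 1 (by decide) (by decide) (by decide), ho 1 0 0 2 (by decide) (by decide) (by decide), ho 1 0 0 3 (by decide) (by decide) (by decide)⟩
    (Q 1 2) ⟨hQd 1 2 (by decide), hQc 2 1 0 (by decide) (by decide) (by decide), hQr 1 2 0 (by decide) (by decide) (by decide), ho 1 2 0 1 (by decide) (by decide) (by decide), ho 1 2 0 3 (by decide) (by decide) (by decide)⟩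
    (Q 1 3) ⟨hQd 1 3 (by decide), hQc 3 1 0 (by decide) (by decide) (by decide), hQr 1 3 0 (by decide) (by decide) (by decide), hQr 1 3 2 (by decide) (by decide) (by decide), ho 1 3 0 1 (by decide) (by decide) (by decide), ho 1 3 0 2 (by decide) (by decide) (by decide)⟩
    (Q 2 0) ⟨hQd 2 0 (by decide), hQc 0 2 1 (by decide) (by decide) (by decide), ho 2 0 0 1 (by decide) (by decide) (by decide), ho 2 0 0 2 (by decide) (by decide) (by decide), ho 2 0 0 3 (by decide) (by decide) (by decide), ho 2 0 1 2 (by decide) (by decide) (by decide), ho 2 0 1 3 (by decide) (by decide) (by decide)⟩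
    (Q 2 1) ⟨hQd 2 1 (by decide), hQc 1 2 0 (by decide) (by decide) (by decide), hQr 2 1 0 (by decide) (by decide) (by decide), ho 2 1 0 2 (by decide) (by decide) (by decide), ho 2 1 0 3 (by decide) (by decide) (by decide), ho 2 1 1 0 (by decide) (by decide) (by decide), ho 2 1 1 2 (by decide) (by decide) (by decide), ho 2 1 1 3 (by decide) (by decide) (by decide)⟩
    (Q 2 3) ⟨hQd 2 3 (by decide), hQc 3 2 0 (by decide) (by decide) (by decide), hQc 3 2 1 (by decide) (by decide) (by decide), hQr 2 3 0 (by decide) (by decide) (by decide), hQr 2 3 1 (by decide) (by decide) (by decide), ho 2 3 0 1 (by decide) (by decide) (by decide), ho 2 3 0 2 (by decide) (by decide) (by decide), ho 2 3 1 0 (by decide) (by decide) (by decide), ho 2 3 1 2 (by decide) (by decide) (by decide)⟩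
    (Q 3 0) ⟨hQd 3 0 (by decide), hQc 0 3 1 (by decide) (by decide) (by decide), hQc 0 3 2 (by decide) (by decide) (by decide), ho 3 0 0 1 (by decide) (by decide) (by decide), ho 3 0 0 2 (by decide) (by decide) (by decide), ho 3 0 0 3 (by decide) (by decide) (by decide), ho 3 0 1 2 (by decide) (by decide) (by decide), ho 3 0 1 3 (by decide) (by decide) (by decide), ho 3 0 2 1 (by decide) (by decide) (by decide), ho 3 0 2 3 (by decide) (by decide) (by decide)⟩
    (Q 3 1) ⟨hQd 3 1 (by decide), hQc 1 3 0 (by decide) (by decide) (by decide), hQc 1 3 2 (by decide) (by decide) (by decide), hQr 3 1 0 (by decide) (by decide) (by decide), ho 3 1 0 2 (by decide) (by decide) (by decide), ho 3 1 0 3 (by decide) (by decide) (by decide), ho 3 1 1 0 (by decide) (by decide) (by decide), ho 3 1 1 2 (by decide) (by decide) (by decide), ho 3 1 1 3 (by decide) (by decide) (by decide), ho 3 1 2 0 (by decide) (by decide) (by decide), ho 3 1 2 3 (by decide) (by decide) (by decide)⟩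
    (Q 3 2) ⟨hQd 3 2 (by decide), hQc 2 3 0 (by decide) (by decide) (by decide), hQc 2 3 1 (by decide) (by decide) (by decide), hQr 3 2 0 (by decide) (by decide) (by decide), hQr 3 2 1 (by decide) (by decide) (by decide), ho 3 2 0 1 (by decide) (by decide) (by decide), ho 3 2 0 3 (by decide) (by decide) (by decide), ho 3 2 1 0 (by decide) (by decide) (by decide), ho 3 2 1 3 (by decide) (by decide) (by decide), ho 3 2 2 0 (by decide) (by decide) (by decide), ho 3 2 2 1 (by decide) (by decide) (by decide), ho 3 2 2 3 (by decide) (by decide) (by decide)⟩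
section
variable {P : Type} [Fintype P] [DecidableEq P]

theorem exists_cls (N : Net64 P) :
    ∃ cls : Fin 4 → P → Fin 6, ∀ i j p, p ∈ N.line i j ↔ cls i p = j := by
  choose f hf using fun (i : Fin 4) (p : P) => N.partition i p
  refine ⟨f, fun i j p => ⟨fun h => ((hf i p).2 j h).symm, ?_⟩⟩
  rintro rfl
  exact (hf i p).1

/-- The combinatorial core: points with four coordinates. -/
theorem core (cls : Fin 4 → P → Fin 6) (Λ : Finset (Fin 4 × Fin 6))
    (hpt : ∀ i j x y, i ≠ j → ∃! p, cls i p = x ∧ cls j p = y)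
    (hc : ∀ i, (Finset.univ.filter fun x : Fin 6 => (i, x) ∈ Λ).card = 2)
    (hev : ∀ p, Even (∑ i, if (i, cls i p) ∈ Λ then 1 else 0)) : False := by
  have huniv : ∀ i j k l : Fin 4, i ≠ j → i ≠ k → i ≠ l → j ≠ k → j ≠ l → k ≠ l →
      (Finset.univ : Finset (Fin 4)) = {i, j, k, l} := by decide
  have hev' : ∀ i j k l : Fin 4, i ≠ j → i ≠ k → i ≠ l → j ≠ k → j ≠ l → k ≠ l → ∀ p,
      Even ((if (i, cls i p) ∈ Λ then 1 else 0) + ((if (j, cls j p) ∈ Λ then 1 else 0) +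
        ((if (k, cls k p) ∈ Λ then 1 else 0) + (if (l, cls l p) ∈ Λ then 1 else 0)))) := by
    intro i j k l h1 h2 h3 h4 h5 h6 p
    have := hev p
    rw [huniv i j k l h1 h2 h3 h4 h5 h6] at this
    rwa [Finset.sum_insert (by simp [*]), Finset.sum_insert (by simp [*]),
      Finset.sum_insert (by simp [*]), Finset.sum_singleton] at this
  -- two coordinates determine a point
  have hinj : ∀ i j, i ≠ j → ∀ p q, cls i p = cls i q → cls j p = cls j q → p = q := by
    intro i j hij p q h1 h2
    exact (hpt i j (cls i q) (cls j q) hij).unique ⟨h1, h2⟩ ⟨rfl, rfl⟩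
  have hsum : ∀ i j x, i ≠ j →
      (∑ p ∈ Finset.univ.filter (fun p => cls i p = x),
        if (j, cls j p) ∈ Λ then 1 else 0) = 2 := by
    intro i j x hij
    rw [← hc j, Finset.card_filter]
    refine Finset.sum_bij (fun p _ => cls j p) (by simp) ?_ ?_ (by simp)
    · intro p hp q hq h
      simp only [Finset.mem_filter, Finset.mem_univ, true_and] at hp hq
      exact hinj i j hij p q (hp.trans hq.symm) h
    · intro y _
      obtain ⟨p, ⟨h1, h2⟩, _⟩ := hpt i j x y hij
      exact ⟨p, by simp [h1], h2⟩
  -- on an unmarked line of class `i` there is exactly one point marked in classes `k`, `l`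
  have huq : ∀ i j k l : Fin 4, i ≠ j → i ≠ k → i ≠ l → j ≠ k → j ≠ l → k ≠ l →
      ∀ x, (i, x) ∉ Λ → ∃! p, cls i p = x ∧ ((k, cls k p) ∈ Λ ∧ (l, cls l p) ∈ Λ) := by
    intro i j k l h1 h2 h3 h4 h5 h6 x hx
    have e1 := hsum i j x h1
    have e2 := hsum i k x h2
    have e3 := hsum i l x h3
    have e4 : 2 * (∑ p ∈ Finset.univ.filter (fun p => cls i p = x),
        if (k, cls k p) ∈ Λ ∧ (l, cls l p) ∈ Λ then 1 else 0) +
        (∑ p ∈ Finset.univ.filter (fun p => cls i p = x),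
          if (j, cls j p) ∈ Λ then 1 else 0) =
        (∑ p ∈ Finset.univ.filter (fun p => cls i p = x),
          if (k, cls k p) ∈ Λ then 1 else 0) +
        (∑ p ∈ Finset.univ.filter (fun p => cls i p = x),
          if (l, cls l p) ∈ Λ then 1 else 0) := by
      rw [Finset.mul_sum, ← Finset.sum_add_distrib, ← Finset.sum_add_distrib]
      refine Finset.sum_congr rfl fun p hp => ?_
      simp only [Finset.mem_filter, Finset.mem_univ, true_and] at hp
      have hE := hev' i j k l h1 h2 h3 h4 h5 h6 p
      rw [hp, if_neg hx] at hE
      by_cases a : (j, cls j p) ∈ Λ <;> by_cases b : (k, cls k p) ∈ Λ <;>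
        by_cases c : (l, cls l p) ∈ Λ <;> simp [a, b, c] at hE ⊢ <;> revert hE <;> decide
    have e5 : (∑ p ∈ Finset.univ.filter (fun p => cls i p = x),
        if (k, cls k p) ∈ Λ ∧ (l, cls l p) ∈ Λ then 1 else 0) = 1 := by omega
    rw [← Finset.card_filter, Finset.card_eq_one] at e5
    obtain ⟨p, hp⟩ := e5
    rw [Finset.filter_filter] at hp
    have hm : ∀ q, (cls i q = x ∧ ((k, cls k q) ∈ Λ ∧ (l, cls l q) ∈ Λ)) ↔ q = p := by
      intro q
      have := Finset.ext_iff.1 hp q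
      simpa using this
    exact ⟨p, (hm p).2 rfl, fun q hq => (hm q).1 hq⟩
  have hpar : ∀ i j k l : Fin 4, i ≠ j → i ≠ k → i ≠ l → j ≠ k → j ≠ l → k ≠ l → ∀ p,
      (i, cls i p) ∉ Λ → (j, cls j p) ∉ Λ → ((k, cls k p) ∈ Λ ↔ (l, cls l p) ∈ Λ) := by
    intro i j k l h1 h2 h3 h4 h5 h6 p a b
    have hE := hev' i j k l h1 h2 h3 h4 h5 h6 p
    by_cases c : (k, cls k p) ∈ Λ <;> by_cases d : (l, cls l p) ∈ Λ <;>
      simp [a, b, c, d] at hE ⊢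
  have hpar3 : ∀ i j k l : Fin 4, i ≠ j → i ≠ k → i ≠ l → j ≠ k → j ≠ l → k ≠ l → ∀ p,
      (i, cls i p) ∉ Λ → (k, cls k p) ∈ Λ → (l, cls l p) ∈ Λ → (j, cls j p) ∉ Λ := by
    intro i j k l h1 h2 h3 h4 h5 h6 p a c d b
    have hE := hev' i j k l h1 h2 h3 h4 h5 h6 p
    simp [a, b, c, d] at hE
    revert hE; decide
  -- enumerate unmarked rows
  have hcU : ∀ i, Fintype.card {x : Fin 6 // (i, x) ∉ Λ} = 4 := by
    intro i
    have h1 := Fintype.card_subtype_compl (fun x : Fin 6 => (i, x) ∈ Λ)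
    rw [Fintype.card_subtype (fun x : Fin 6 => (i, x) ∈ Λ), hc i] at h1
    simpa using h1
  let e0 : Fin 4 ≃ {x : Fin 6 // ((0 : Fin 4), x) ∉ Λ} := (Fintype.equivFinOfCardEq (hcU 0)).symm
  -- the matching with another class
  have hmatch : ∀ j k l : Fin 4, 0 ≠ j → 0 ≠ k → 0 ≠ l → j ≠ k → j ≠ l → k ≠ l →
      ∃ (e : Fin 4 → Fin 6) (pt : Fin 4 → P), Function.Injective e ∧
        (∀ r, (j, e r) ∉ Λ) ∧ (∀ x, (j, x) ∉ Λ → ∃ r, e r = x) ∧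
        (∀ r, cls 0 (pt r) = e0 r ∧ cls j (pt r) = e r ∧ (k, cls k (pt r)) ∈ Λ ∧
          (l, cls l (pt r)) ∈ Λ) := by
    intro j k l h1 h2 h3 h4 h5 h6
    choose pt hp _ using fun r => huq 0 j k l h1 h2 h3 h4 h5 h6 (e0 r) (e0 r).2
    have hn : ∀ r, (j, cls j (pt r)) ∉ Λ := fun r =>
      hpar3 0 j k l h1 h2 h3 h4 h5 h6 (pt r) (by rw [(hp r).1]; exact (e0 r).2)
        (hp r).2.1 (hp r).2.2
    have hi : Function.Injective fun r => cls j (pt r) := by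
      intro r s hrs
      have := (huq j 0 k l h1.symm h4 h5 h2 h3 h6 (cls j (pt s)) (hn s)).unique
        ⟨hrs, (hp r).2⟩ ⟨rfl, (hp s).2⟩
      have h0 : (e0 r : Fin 6) = e0 s := by rw [← (hp r).1, ← (hp s).1, this]
      exact e0.injective (Subtype.ext h0)
    refine ⟨fun r => cls j (pt r), pt, hi, hn, ?_, fun r => ⟨(hp r).1, rfl, (hp r).2⟩⟩
    let g : Fin 4 → {x : Fin 6 // (j, x) ∉ Λ} := fun r => ⟨cls j (pt r), hn r⟩
    have hg : Function.Bijective g := by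
      rw [Fintype.bijective_iff_injective_and_card]
      refine ⟨fun r s h => hi (Subtype.ext_iff.1 h), ?_⟩
      rw [hcU j]; rfl
    intro x hx
    obtain ⟨r, hr⟩ := hg.2 ⟨x, hx⟩
    exact ⟨r, Subtype.ext_iff.1 hr⟩
  obtain ⟨e1, p1, i1, n1, s1, q1⟩ := hmatch 1 2 3 (by decide) (by decide) (by decide)
    (by decide) (by decide) (by decide)
  obtain ⟨e2, p2, i2, n2, s2, q2⟩ := hmatch 2 1 3 (by decide) (by decide) (by decide)
    (by decide) (by decide) (by decide)
  obtain ⟨e3, p3, i3, n3, s3, q3⟩ := hmatch 3 1 2 (by decide) (by decide) (by decide)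
    (by decide) (by decide) (by decide)
  -- the point in cell `(r, c)`
  choose X hX _ using fun r c : Fin 4 => hpt 0 1 (e0 r) (e1 c) (by decide)
  have hX0 : ∀ r c, (0, cls 0 (X r c)) ∉ Λ := fun r c => by rw [(hX r c).1]; exact (e0 r).2
  have hX1 : ∀ r c, (1, cls 1 (X r c)) ∉ Λ := fun r c => by rw [(hX r c).2]; exact n1 c
  have hX23 : ∀ r c, (2, cls 2 (X r c)) ∈ Λ ↔ (3, cls 3 (X r c)) ∈ Λ := fun r c =>
    hpar 0 1 2 3 (by decide) (by decide) (by decide) (by decide) (by decide) (by decide)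
      (X r c) (hX0 r c) (hX1 r c)
  have hX2 : ∀ r c, r ≠ c → (2, cls 2 (X r c)) ∉ Λ := by
    intro r c hrc h
    have := (huq 0 1 2 3 (by decide) (by decide) (by decide) (by decide) (by decide)
      (by decide) (e0 r) (e0 r).2).unique ⟨(hX r c).1, h, (hX23 r c).1 h⟩
      ⟨(q1 r).1, (q1 r).2.2⟩
    apply hrc
    apply i1
    rw [← (q1 r).2.1, ← this, (hX r c).2]
  have hX3 : ∀ r c, r ≠ c → (3, cls 3 (X r c)) ∉ Λ := fun r c hrc h =>
    hX2 r c hrc ((hX23 r c).2 h)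
  have hM : ∀ r c, ∃ a, r ≠ c → e2 a = cls 2 (X r c) := by
    intro r c
    by_cases h : r = c
    · exact ⟨0, fun h' => absurd h h'⟩
    · obtain ⟨a, ha⟩ := s2 _ (hX2 r c h)
      exact ⟨a, fun _ => ha⟩
  have hQ : ∀ r c, ∃ a, r ≠ c → e3 a = cls 3 (X r c) := by
    intro r c
    by_cases h : r = c
    · exact ⟨0, fun h' => absurd h h'⟩
    · obtain ⟨a, ha⟩ := s3 _ (hX3 r c h)
      exact ⟨a, fun _ => ha⟩
  choose M hM using hM
  choose Q hQ using hQ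
  have row : ∀ r r' c c', X r c = X r' c' → r = r' ∧ c = c' := by
    intro r r' c c' h
    refine ⟨e0.injective (Subtype.ext ?_), i1 ?_⟩
    · rw [← (hX r c).1, ← (hX r' c').1, h]
    · rw [← (hX r c).2, ← (hX r' c').2, h]
  refine no_pair M Q ?_ ?_ ?_ ?_ ?_ ?_ ?_ ?_
  · intro r c hrc h
    have : X r c = p2 r := hinj 0 2 (by decide) _ _ ((hX r c).1.trans (q2 r).1.symm)
      (by rw [← hM r c hrc, h, (q2 r).2.1])
    exact hX1 r c (this ▸ (q2 r).2.2.1)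
  · intro r c c' h h' hcc hm
    have : X r c = X r c' := hinj 0 2 (by decide) _ _ ((hX r c).1.trans (hX r c').1.symm)
      (by rw [← hM r c h, hm, hM r c' h'])
    exact hcc (row _ _ _ _ this).2
  · intro c r r' h h' hcc hm
    have : X r c = X r' c := hinj 1 2 (by decide) _ _ ((hX r c).2.trans (hX r' c).2.symm)
      (by rw [← hM r c h, hm, hM r' c h'])
    exact hcc (row _ _ _ _ this).1
  · intro c
    obtain ⟨s, ⟨hs1, hs2⟩, _⟩ := hpt 1 2 (e1 c) (e2 c) (by decide)
    have hs03 := hpar 1 2 0 3 (by decide) (by decide) (by decide) (by decide) (by decide)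
      (by decide) s (by rw [hs1]; exact n1 c) (by rw [hs2]; exact n2 c)
    by_cases h0 : (0, cls 0 s) ∈ Λ
    · exfalso
      have h3 := hs03.1 h0
      -- three points on pairwise different lines of class 3, all marked
      have d12 : cls 3 (p1 c) ≠ cls 3 (p2 c) := by
        intro h
        have := hinj 0 3 (by decide) _ _ ((q1 c).1.trans (q2 c).1.symm) h
        exact n1 c ((q1 c).2.1 ▸ this ▸ (q2 c).2.2.1)
      have d1s : cls 3 (p1 c) ≠ cls 3 s := by
        intro h
        have := hinj 1 3 (by decide) _ _ ((q1 c).2.1.trans hs1.symm) h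
        rw [← this, (q1 c).1] at h0
        exact (e0 c).2 h0
      have d2s : cls 3 (p2 c) ≠ cls 3 s := by
        intro h
        have := hinj 2 3 (by decide) _ _ ((q2 c).2.1.trans hs2.symm) h
        rw [← this, (q2 c).1] at h0
        exact (e0 c).2 h0
      have hsub : ({cls 3 (p1 c), cls 3 (p2 c), cls 3 s} : Finset (Fin 6)) ⊆
          Finset.univ.filter fun x : Fin 6 => ((3 : Fin 4), x) ∈ Λ := by
        intro x hx
        simp only [Finset.mem_insert, Finset.mem_singleton] at hx
        simp only [Finset.mem_filter, Finset.mem_univ, true_and]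
        rcases hx with rfl | rfl | rfl
        · exact (q1 c).2.2.2
        · exact (q2 c).2.2.2
        · exact h3
      have := Finset.card_le_card hsub
      rw [hc 3, Finset.card_eq_three.2 ⟨_, _, _, d12, d1s, d2s, rfl⟩] at this
      omega
    · obtain ⟨r, hr⟩ := e0.surjective ⟨cls 0 s, h0⟩
      have hr' : (e0 r : Fin 6) = cls 0 s := by rw [hr]
      have hXs : X r c = s := hinj 0 1 (by decide) _ _ ((hX r c).1.trans hr')
        ((hX r c).2.trans hs1.symm)
      have hrc : r ≠ c := by
        rintro rfl
        have : p1 r = s := hinj 0 1 (by decide) _ _ ((q1 r).1.trans hr')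
          ((q1 r).2.1.trans hs1.symm)
        have h2 := (q1 r).2.2.1
        rw [this, hs2] at h2
        exact n2 r h2
      exact ⟨r, hrc, i2 (by rw [hM r c hrc, hXs, hs2])⟩
  · intro r c hrc h
    have : X r c = p3 r := hinj 0 3 (by decide) _ _ ((hX r c).1.trans (q3 r).1.symm)
      (by rw [← hQ r c hrc, h, (q3 r).2.1])
    exact hX1 r c (this ▸ (q3 r).2.2.1)
  · intro r c c' h h' hcc hm
    have : X r c = X r c' := hinj 0 3 (by decide) _ _ ((hX r c).1.trans (hX r c').1.symm)
      (by rw [← hQ r c h, hm, hQ r c' h'])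
    exact hcc (row _ _ _ _ this).2
  · intro c r r' h h' hcc hm
    have : X r c = X r' c := hinj 1 3 (by decide) _ _ ((hX r c).2.trans (hX r' c).2.symm)
      (by rw [← hQ r c h, hm, hQ r' c h'])
    exact hcc (row _ _ _ _ this).1
  · intro r c r' c' h h' hrr hm hq
    have : X r c = X r' c' := hinj 2 3 (by decide) _ _
      (by rw [← hM r c h, hm, hM r' c' h']) (by rw [← hQ r c h, hq, hQ r' c' h'])
    exact hrr (row _ _ _ _ this).1

end

/-- In a `(6,4)` net there is no set of lines consisting of exactly two lines from each
parallel class (parallax `(2,2,2,2)`) whose `F₂`-sum of characteristic functions vanishes. -/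
theorem net64_no_2222_dependency {P : Type} [Fintype P] [DecidableEq P] (N : Net64 P)
    (Λ : Finset (Fin 4 × Fin 6)) (hl : ∀ i : Fin 4, lcount Λ i = 2) :
    N.cSum Λ ≠ 0 := by
  intro h0
  obtain ⟨cls, hcls⟩ := exists_cls N
  refine core cls Λ ?_ ?_ ?_
  · intro i j x y hij
    obtain ⟨p, hp⟩ := Finset.card_eq_one.1 (N.meet i j x y hij)
    have hm : ∀ q, (cls i q = x ∧ cls j q = y) ↔ q = p := by
      intro q
      have := Finset.ext_iff.1 hp q
      simpa [hcls] using this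
    exact ⟨p, (hm p).2 rfl, fun q hq => (hm q).1 hq⟩
  · intro i
    rw [← hl i, lcount]
    refine Finset.card_bij (fun x _ => (i, x)) (by simp) (by simp) ?_
    rintro ⟨a, b⟩ hb
    simp only [Finset.mem_filter] at hb
    obtain ⟨hb, rfl⟩ := hb
    exact ⟨b, by simpa using hb, rfl⟩
  · intro p
    have h1 := congrFun h0 p
    rw [← ZMod.natCast_eq_zero_iff_even]
    rw [Net64.cSum, Finset.sum_apply] at h1
    rw [← Finset.univ_inter Λ, ← Finset.sum_ite_mem, Fintype.sum_prod_type] at h1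
    rw [Nat.cast_sum, ← Pi.zero_apply (M := fun _ : P => ZMod 2) p, ← h1]
    refine Finset.sum_congr rfl fun i _ => ?_
    rw [Finset.sum_eq_single (cls i p)]
    · simp [chi, hcls]
    · intro b _ hb
      simp [chi, hcls, hb.symm]
    · simp
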